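/- Let (ℛ,≤,r) be a topological Ramsey space, and let 𝒳 ⊆ ℛ and a nonempty basic open set [a,A] be given. Then player I has a winning strategy in the abstract Kastanas game 𝒢_{[a,A]}(𝒳) if and only if there exists H ∈ [a,A] such that [a,H] ⊆ 𝒳. -/

import Mathlib

open scoped Topology

namespace AbstractTRS

/-- A combinatorial structure `(ℛ, ≤, r)`: a quasi-ordered set `R` of objects together with
approximation mappings `r : R → ℕ → α` and a finitization relation `≤_fin` on approximations. -/
structure CombStruct (R : Type) (α : Type) where
  le : R → R → Prop
  le_refl : ∀ A, le A A
  le_trans : ∀ {A B C}, le A B → le B C → le A C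
  r : R → ℕ → α
  lefin : α → α → Prop

namespace CombStruct

variable {R α : Type} (S : CombStruct R α)

/-- `𝒜ℛ`, the set of all finite approximations. -/
def AR : Set α := {a | ∃ (A : R) (n : ℕ), S.r A n = a}

/-- `𝒜ℛ_n`, the set of all `n`-approximations. -/
def ARn (n : ℕ) : Set α := {a | ∃ A : R, S.r A n = a}

/-- `a ⊑ b` : `a` is an initial segment of `b`. -/
def Init (a b : α) : Prop := ∃ (C : R) (n m : ℕ), n ≤ m ∧ S.r C n = a ∧ S.r C m = b

/-- `a ⊏ b` : `a` is a proper initial segment of `b`. -/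
def PInit (a b : α) : Prop := S.Init a b ∧ a ≠ b

/-- The basic set `[a, B]`, where `na = |a|` is the length of `a`. -/
def seg (a : α) (na : ℕ) (B : R) : Set R := {X | S.le X B ∧ S.r X na = a}

/-- `[n, B] = [r_n(B), B]`. -/
def segN (n : ℕ) (B : R) : Set R := S.seg (S.r B n) n B

/-- `depth_B(a) < ∞`. -/
def hasDepth (B : R) (a : α) : Prop := ∃ n, S.lefin a (S.r B n)

/-- `depth_B(a)` : the minimal `n` with `a ≤_fin r_n(B)` (junk value `0` if there is none). -/
noncomputable def depth (B : R) (a : α) : ℕ :=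
  letI : DecidablePred fun n => S.lefin a (S.r B n) := Classical.decPred _
  letI : Decidable (∃ n, S.lefin a (S.r B n)) := Classical.dec _
  if h : ∃ n, S.lefin a (S.r B n) then Nat.find h else 0

/-- `r_n''[a,B]`, where `na = |a|`. -/
def rimg (n : ℕ) (a : α) (na : ℕ) (B : R) : Set α :=
  {d | ∃ D ∈ S.seg a na B, S.r D n = d}

/-- Axioms A.1 (metrization). -/
def A1 : Prop :=
  (∀ A B : R, S.r A 0 = S.r B 0) ∧
  (∀ A B : R, A ≠ B → ∃ n, S.r A n ≠ S.r B n) ∧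
  (∀ (A B : R) (n m : ℕ), S.r A n = S.r B m → n = m ∧ ∀ k ≤ n, S.r A k = S.r B k)

/-- Axioms A.2 (finitization): `≤_fin` is a quasi-order on `𝒜ℛ` satisfying A.2.1–A.2.3. -/
def A2 : Prop :=
  (∀ a ∈ S.AR, S.lefin a a) ∧
  (∀ a b c : α, S.lefin a b → S.lefin b c → S.lefin a c) ∧
  (∀ b : α, {a : α | S.lefin a b}.Finite) ∧
  (∀ A B : R, S.le A B ↔ ∀ n : ℕ, ∃ m : ℕ, S.lefin (S.r A n) (S.r B m)) ∧
  (∀ a b c : α, S.Init a b → S.lefin b c → ∃ d : α, S.Init d c ∧ S.lefin a d)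

/-- Axioms A.3 (amalgamation). -/
def A3 : Prop :=
  (∀ (a : α) (na : ℕ), a ∈ S.ARn na → ∀ B : R, S.hasDepth B a →
    ∀ A ∈ S.segN (S.depth B a) B, (S.seg a na A).Nonempty) ∧
  (∀ (a : α) (na : ℕ), a ∈ S.ARn na → ∀ A B : R, S.le A B →
    S.hasDepth B a → S.hasDepth A a → S.depth A a ≤ S.depth B a →
    ∃ A' ∈ S.segN (S.depth B a) B, S.seg a na A' ⊆ S.seg a na A)

/-- Axiom A.4 (abstract pigeonhole principle). -/
def A4 : Prop :=
  ∀ (a : α) (na : ℕ), a ∈ S.ARn na → ∀ B : R, S.hasDepth B a →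
    ∀ O : Set α, O ⊆ S.ARn (na + 1) →
      ∃ A ∈ S.segN (S.depth B a) B,
        S.rimg (na + 1) a na A ⊆ O ∨ O ∩ S.rimg (na + 1) a na A = ∅

/-- `⟨b,B⟩_m^A = {X ∈ [b,B] : depth_A(r_{|b|+1}(X)) > m}`, where `nb = |b|`. -/
def angle (b : α) (nb : ℕ) (B A : R) (m : ℕ) : Set R :=
  {X | X ∈ S.seg b nb B ∧ (S.hasDepth A (S.r X (nb + 1)) → m < S.depth A (S.r X (nb + 1)))}

/-- Axiom A.3*.1 (first axiom of strong amalgamation). -/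
def A3star1 : Prop :=
  ∀ (b : α) (nb : ℕ), b ∈ S.ARn nb → ∀ (A : R) (m : ℕ),
    S.hasDepth A b → S.depth A b ≤ m →
    ∀ B ∈ S.segN m A, (S.angle b nb B A m).Nonempty

/-- Axiom A.3*.2 (second axiom of strong amalgamation). -/
def A3star2 : Prop :=
  ∀ (b : α) (nb : ℕ), b ∈ S.ARn nb → ∀ (A B : R) (m : ℕ), S.le B A →
    S.hasDepth A b → S.depth A b ≤ m → S.hasDepth B b → S.depth B b ≤ S.depth A b →
    ∃ B' ∈ S.segN m A, S.angle b nb B' A m ⊆ S.angle b nb B A m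

/-- Axioms A.3* (strong amalgamation). -/
def A3star : Prop := S.A3star1 ∧ S.A3star2

/-- The structure is metrically closed: `ℛ`, identified with the set of sequences
`(r_n(A))_n`, is closed in `α^ℕ` with `α` discrete. -/
def MetricallyClosed : Prop :=
  @IsClosed (ℕ → α) (@Pi.topologicalSpace ℕ (fun _ => α) (fun _ => ⊥))
    {f | ∃ A : R, ∀ n, f n = S.r A n}

/-- The basic (open) sets `[a,B]` of the Ellentuck topology. -/
def IsBasic (U : Set R) : Prop :=
  ∃ (a : α) (na : ℕ) (B : R), a ∈ S.ARn na ∧ U = S.seg a na B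

/-- The Ellentuck topology on `ℛ`, generated by the basic sets `[a,B]`. -/
def ellentuck : TopologicalSpace R :=
  TopologicalSpace.generateFrom {U | S.IsBasic U}

/-- `(ℛ,≤,r)` is a topological Ramsey space. -/
def IsTRS : Prop := S.MetricallyClosed ∧ S.A1 ∧ S.A2 ∧ S.A3 ∧ S.A4

/-- `(ℛ,≤,r)` is a strong topological Ramsey space. -/
def IsStrongTRS : Prop := S.MetricallyClosed ∧ S.A1 ∧ S.A2 ∧ S.A3star ∧ S.A4

/-- `𝒳 ⊆ ℛ` is Ramsey. -/
def RamseySet (X : Set R) : Prop :=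
  ∀ (a : α) (na : ℕ) (A : R), a ∈ S.ARn na → (S.seg a na A).Nonempty →
    ∃ B ∈ S.seg a na A, S.seg a na B ⊆ X ∨ S.seg a na B ∩ X = ∅

/-- `𝒳 ⊆ ℛ` is Ramsey null. -/
def RamseyNull (X : Set R) : Prop :=
  ∀ (a : α) (na : ℕ) (A : R), a ∈ S.ARn na → (S.seg a na A).Nonempty →
    ∃ B ∈ S.seg a na A, S.seg a na B ∩ X = ∅

/-- `𝒳` is nowhere dense (with respect to the basis of the Ellentuck topology). -/
def NwdB (X : Set R) : Prop :=
  ∀ U : Set R, S.IsBasic U → U.Nonempty →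
    ∃ V : Set R, S.IsBasic V ∧ V.Nonempty ∧ V ⊆ U ∧ V ∩ X = ∅

/-- `𝒳` is meager: a countable union of nowhere dense sets. -/
def MeagerB (X : Set R) : Prop :=
  ∃ f : ℕ → Set R, (∀ i, S.NwdB (f i)) ∧ X = ⋃ i, f i

/-- `𝒳` has the abstract Baire property. -/
def ABP (X : Set R) : Prop :=
  ∀ U : Set R, S.IsBasic U → U.Nonempty →
    ∃ V : Set R, S.IsBasic V ∧ V.Nonempty ∧ V ⊆ U ∧ (V ⊆ X ∨ V ∩ X = ∅)

/-- `𝒳` has the Baire property: `𝒳 △ 𝒪` is meager for some open set `𝒪`. -/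
def BP (X : Set R) : Prop :=
  ∃ O : Set R, IsOpen[S.ellentuck] O ∧ S.MeagerB (symmDiff X O)

/-- `ℛ ↾ H = {A ∈ ℛ : A ≤ H}`. -/
def restrict (H : R) : Set R := {A | S.le A H}

/-- `𝒮_b^𝒬 = {D ∈ ℛ : ∅ ≠ [b,D] ⊆ 𝒬}`, where `nb = |b|`. -/
def Sb (Q : Set R) (b : α) (nb : ℕ) : Set R :=
  {D | (S.seg b nb D).Nonempty ∧ S.seg b nb D ⊆ Q}

/-- `D∞` is a diagonalization of the sequence `{D_n}` inside `[a,B]`: for every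
`b ∈ 𝒜ℛ↾[a,D∞]` (with `|b| = nb`) one has `∅ ≠ [b,D∞] ⊆ [b,D_{n_b}]`,
where `n_b = depth_B(b) - depth_B(a)`. -/
def Diag (a : α) (B : R) (D : ℕ → R) (Dinf : R) : Prop :=
  ∀ (b : α) (nb : ℕ), b ∈ S.ARn nb → S.Init a b → S.hasDepth Dinf b →
    (S.seg b nb Dinf).Nonempty ∧
    S.seg b nb Dinf ⊆ S.seg b nb (D (S.depth B b - S.depth B a))

/-- The space is selective: decreasing sequences inside nonempty basic sets admit
diagonalizations. -/
def Selective : Prop :=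
  ∀ (a : α) (na : ℕ) (B : R), a ∈ S.ARn na → (S.seg a na B).Nonempty →
    ∀ D : ℕ → R, (∀ n, D n ∈ S.seg a na B) → (∀ n, S.le (D (n + 1)) (D n)) →
      ∃ Dinf ∈ S.seg a na B, S.Diag a B D Dinf

/-! ### The abstract Kastanas game `𝒢_{[a₀,B₀]}(𝒳)`

Player I plays objects `A 0, A 1, A 2, …` (the paper's `A₁, A₂, …`) and player II answers
with basic sets `[ak (k+1), Bk (k+1)]` (the paper's `[a₁,B₁], [a₂,B₂], …`), where
`ak 0 = a₀` and `Bk 0 = B₀`; `na = |a₀|`, so `|ak k| = na + k`. -/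

/-- The moves of player I induced by a strategy `σ` (which sees II's previous moves). -/
def playI (σ : List (α × R) → R) (ak : ℕ → α) (Bk : ℕ → R) (k : ℕ) : R :=
  σ (List.ofFn fun i : Fin k => (ak (i.1 + 1), Bk (i.1 + 1)))

/-- Rule for player I's k-th move: `A_{k+1} ∈ [a_k, B_k]`. -/
def ruleI (na : ℕ) (ak : ℕ → α) (Bk : ℕ → R) (A : ℕ → R) (k : ℕ) : Prop :=
  A k ∈ S.seg (ak k) (na + k) (Bk k)

/-- Rule for player II's k-th move: `a_k ⊏ a_{k+1}`, `|a_{k+1}| = |a_k| + 1` and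
`B_{k+1} ∈ [a_{k+1}, A_{k+1}]`. -/
def ruleII (na : ℕ) (ak : ℕ → α) (Bk : ℕ → R) (A : ℕ → R) (k : ℕ) : Prop :=
  (∃ C : R, S.r C (na + k) = ak k ∧ S.r C (na + k + 1) = ak (k + 1)) ∧
  ak k ≠ ak (k + 1) ∧
  Bk (k + 1) ∈ S.seg (ak (k + 1)) (na + k + 1) (A k)

/-- The outcome `B∞`, determined by `{B∞} = ⋂ₖ [a_k]`, belongs to `X`. -/
def limitMem (na : ℕ) (ak : ℕ → α) (X : Set R) : Prop :=
  ∀ Binf : R, ({Binf} : Set R) = ⋂ k : ℕ, {Y : R | S.r Y (na + k) = ak k} → Binf ∈ X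

/-- `σ` is a winning strategy for player I in `𝒢_{[a,B₀]}(𝒳)`: it plays legally at every
legal position consistent with it, and every legal play following it is won by player I. -/
def IWinning (X : Set R) (a : α) (na : ℕ) (B0 : R) (σ : List (α × R) → R) : Prop :=
  (∀ (ak : ℕ → α) (Bk : ℕ → R), ak 0 = a → Bk 0 = B0 → ∀ k : ℕ,
      (∀ i < k, S.ruleII na ak Bk (playI σ ak Bk) i) →
      S.ruleI na ak Bk (playI σ ak Bk) k) ∧
  (∀ (ak : ℕ → α) (Bk : ℕ → R), ak 0 = a → Bk 0 = B0 →
      (∀ k : ℕ, S.ruleI na ak Bk (playI σ ak Bk) k ∧ S.ruleII na ak Bk (playI σ ak Bk) k) →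
      S.limitMem na ak X)

/-- First components of player II's moves induced by a strategy `τ`. -/
def playIIa (a : α) (τ : List R → α × R) (A : ℕ → R) : ℕ → α
  | 0 => a
  | k + 1 => (τ (List.ofFn fun i : Fin (k + 1) => A i.1)).1

/-- Second components of player II's moves induced by a strategy `τ`. -/
def playIIB (B0 : R) (τ : List R → α × R) (A : ℕ → R) : ℕ → R
  | 0 => B0
  | k + 1 => (τ (List.ofFn fun i : Fin (k + 1) => A i.1)).2

/-- `τ` is a winning strategy for player II in `𝒢_{[a,B₀]}(𝒳)`: it plays legally at every
legal position consistent with it, and every legal play following it is won by player II. -/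
def IIWinning (X : Set R) (a : α) (na : ℕ) (B0 : R) (τ : List R → α × R) : Prop :=
  (∀ (A : ℕ → R) (k : ℕ),
      (∀ i ≤ k, S.ruleI na (playIIa a τ A) (playIIB B0 τ A) A i) →
      (∀ i < k, S.ruleII na (playIIa a τ A) (playIIB B0 τ A) A i) →
      S.ruleII na (playIIa a τ A) (playIIB B0 τ A) A k) ∧
  (∀ A : ℕ → R,
      (∀ k : ℕ, S.ruleI na (playIIa a τ A) (playIIB B0 τ A) A k ∧
        S.ruleII na (playIIa a τ A) (playIIB B0 τ A) A k) →
      ∀ Binf : R,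
        ({Binf} : Set R) = ⋂ k : ℕ, {Y : R | S.r Y (na + k) = playIIa a τ A k} →
        Binf ∉ X)

/-! ### Depth, neighbourhoods and fusion -/

theorem depth_eq_find {B : R} {b : α} (h : S.hasDepth B b) :
    S.depth B b = @Nat.find (fun n => S.lefin b (S.r B n)) (Classical.decPred _) h :=
  dif_pos (h : ∃ n, S.lefin b (S.r B n))

theorem depth_le {B : R} {b : α} {n : ℕ} (h : S.lefin b (S.r B n)) : S.depth B b ≤ n := by
  rw [S.depth_eq_find ⟨n, h⟩]
  exact @Nat.find_min' _ (Classical.decPred _) _ _ h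

theorem lefin_depth {B : R} {b : α} (h : S.hasDepth B b) : S.lefin b (S.r B (S.depth B b)) := by
  rw [S.depth_eq_find h]
  exact @Nat.find_spec (fun n => S.lefin b (S.r B n)) (Classical.decPred _) h

theorem seg_mono {A B : R} (h : S.le A B) (b : α) (n : ℕ) : S.seg b n A ⊆ S.seg b n B :=
  fun _ hX => ⟨S.le_trans hX.1 h, hX.2⟩

theorem rimg_mono {A B : R} (h : S.le A B) (b : α) (n m : ℕ) :
    S.rimg m b n A ⊆ S.rimg m b n B :=
  fun _ ⟨D, hD, hd⟩ => ⟨D, S.seg_mono h b n hD, hd⟩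

theorem self_mem_segN (n : ℕ) (B : R) : B ∈ S.segN n B := ⟨S.le_refl B, rfl⟩

variable {S}

theorem IsTRS.r_injective (hS : S.IsTRS) {A B : R} {n m : ℕ} (h : S.r A n = S.r B m) : n = m :=
  (hS.2.1.2.2 A B n m h).1

theorem IsTRS.r_eq_of_le (hS : S.IsTRS) {A B : R} {n k : ℕ} (h : S.r A n = S.r B n)
    (hk : k ≤ n) : S.r A k = S.r B k :=
  (hS.2.1.2.2 A B n n h).2 k hk

theorem IsTRS.ext_of_r (hS : S.IsTRS) {A B : R} (h : ∀ n, S.r A n = S.r B n) : A = B := by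
  by_contra hne
  obtain ⟨n, hn⟩ := hS.2.1.2.1 A B hne
  exact hn (h n)

theorem IsTRS.segN_trans (hS : S.IsTRS) {A B C : R} {k j : ℕ} (hAB : A ∈ S.segN j B)
    (hBC : B ∈ S.segN k C) (hkj : k ≤ j) : A ∈ S.segN k C :=
  ⟨S.le_trans hAB.1 hBC.1, (hS.r_eq_of_le hAB.2 hkj).trans hBC.2⟩

theorem IsTRS.hasDepth_of_le (hS : S.IsTRS) {A B : R} (h : S.le A B) (n : ℕ) :
    S.hasDepth B (S.r A n) :=
  (hS.2.2.1.2.2.2.1 A B).1 h n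

theorem IsTRS.hasDepth_mono (hS : S.IsTRS) {A B : R} (h : S.le A B) {b : α}
    (hb : S.hasDepth A b) : S.hasDepth B b := by
  obtain ⟨n, hn⟩ := hb
  obtain ⟨m, hm⟩ := hS.hasDepth_of_le h n
  exact ⟨m, hS.2.2.1.2.1 _ _ _ hn hm⟩

theorem IsTRS.lefin_self (hS : S.IsTRS) (A : R) (n : ℕ) : S.lefin (S.r A n) (S.r A n) :=
  hS.2.2.1.1 _ ⟨A, n, rfl⟩

/-- Passing to a member of `[j, B]` does not change depths that are at most `j`. -/
theorem IsTRS.depth_eq_of_mem_segN (hS : S.IsTRS) {A B : R} {b : α} {j : ℕ}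
    (hA : A ∈ S.segN j B) (hb : S.hasDepth B b) (hj : S.depth B b ≤ j) :
    S.hasDepth A b ∧ S.depth A b = S.depth B b := by
  have h1 : S.lefin b (S.r A (S.depth B b)) := by
    rw [hS.r_eq_of_le hA.2 hj]
    exact S.lefin_depth hb
  have h2 : S.depth A b ≤ S.depth B b := S.depth_le h1
  refine ⟨⟨_, h1⟩, le_antisymm h2 (S.depth_le ?_)⟩
  rw [← hS.r_eq_of_le hA.2 (h2.trans hj)]
  exact S.lefin_depth ⟨_, h1⟩

theorem IsTRS.seg_nonempty (hS : S.IsTRS) {b : α} {n : ℕ} (hb : b ∈ S.ARn n) {B : R}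
    (hB : S.hasDepth B b) : (S.seg b n B).Nonempty :=
  hS.2.2.2.1.1 b n hb B hB B (S.self_mem_segN _ _)

theorem IsTRS.le_depth_of_mem_segN (hS : S.IsTRS) {A B : R} {b : α} {k : ℕ}
    (hA : A ∈ S.segN k B) (hk : k ≤ S.depth B b) (hb : S.hasDepth A b) : k ≤ S.depth A b := by
  by_contra h
  refine h (hk.trans (S.depth_le ?_))
  rw [← hS.r_eq_of_le hA.2 (not_le.1 h).le]
  exact S.lefin_depth hb

theorem IsTRS.mem_segN_of_le (hS : S.IsTRS) {k : ℕ → ℕ} (hk : Monotone k) {D : ℕ → R}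
    (hD : ∀ i, D (i + 1) ∈ S.segN (k i) (D i)) {i j : ℕ} (hij : i ≤ j) :
    D j ∈ S.segN (k i) (D i) := by
  induction j, hij using Nat.le_induction with
  | base => exact S.self_mem_segN _ _
  | succ j hij ih =>
    exact hS.segN_trans (hS.segN_trans (hD j) (S.self_mem_segN _ _) (hk hij)) ih le_rfl

/-- A fusion sequence whose depths are witnessed by distinct approximations fixes
arbitrarily long approximations. -/
theorem IsTRS.exists_le_of_injective (hS : S.IsTRS) {k : ℕ → ℕ} (hk : Monotone k) {D : ℕ → R}
    (hD : ∀ i, D (i + 1) ∈ S.segN (k i) (D i)) {b : ℕ → α} (hb : Function.Injective b)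
    (hbD : ∀ i, S.lefin (b i) (S.r (D i) (k i))) (n : ℕ) : ∃ i, n ≤ k i := by
  by_contra! h
  have hbdd : BddAbove (Set.range k) := ⟨n, by rintro _ ⟨i, rfl⟩; exact (h i).le⟩
  obtain ⟨i, hi⟩ := Nat.sSup_mem (Set.range_nonempty k) hbdd
  have hmax : ∀ j, k j ≤ k i := fun j => hi ▸ le_csSup hbdd ⟨j, rfl⟩
  refine Set.infinite_of_injective_forall_mem (f := fun t => b (i + t))
    (hb.comp (add_right_injective i)) (fun t => ?_) (hS.2.2.1.2.2.1 (S.r (D i) (k i)))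
  have := hbD (i + t)
  rwa [le_antisymm (hmax (i + t)) (hk (Nat.le_add_right i t)),
    (hS.mem_segN_of_le hk hD (Nat.le_add_right i t)).2] at this

theorem IsTRS.exists_fusion_limit (hS : S.IsTRS) {k : ℕ → ℕ} (hk : Monotone k)
    (hku : ∀ n, ∃ i, n ≤ k i) (D : ℕ → R) (hD : ∀ i, D (i + 1) ∈ S.segN (k i) (D i)) :
    ∃ H, ∀ i, H ∈ S.segN (k i) (D i) := by
  have hmem : ∀ i j, i ≤ j → D j ∈ S.segN (k i) (D i) := fun i j => hS.mem_segN_of_le hk hD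
  choose e he using hku
  have hagree : ∀ {n i j : ℕ}, n ≤ k i → i ≤ j → S.r (D j) n = S.r (D i) n :=
    fun hn hij => hS.r_eq_of_le (hmem _ _ hij).2 hn
  have hlim : ∃ H : R, ∀ n, S.r (D (e n)) n = S.r H n := by
    let _ : TopologicalSpace α := ⊥
    have hc : IsClosed {f : ℕ → α | ∃ A : R, ∀ n, f n = S.r A n} := hS.1
    refine hc.mem_of_tendsto (x := fun n => S.r (D (e n)) n) (f := fun i => S.r (D i))
      (b := Filter.atTop) ?_ (Filter.Eventually.of_forall fun i => ⟨D i, fun _ => rfl⟩)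
    rw [tendsto_pi_nhds]
    intro n
    refine tendsto_const_nhds.congr' ?_
    filter_upwards [Filter.eventually_ge_atTop (e n)] with m hm
    exact (hagree (he n) hm).symm
  obtain ⟨H, hH⟩ := hlim
  have hHr : ∀ {i n : ℕ}, n ≤ k i → S.r H n = S.r (D i) n := by
    intro i n hn
    rw [← hH n]
    rcases le_total (e n) i with h | h
    · exact (hagree (he n) h).symm
    · exact hagree hn h
  refine ⟨H, fun i => ⟨?_, hHr le_rfl⟩⟩
  rw [hS.2.2.1.2.2.2.1]
  intro n
  rw [hHr ((he n).trans (hk (le_max_left (e n) i)))]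
  exact hS.hasDepth_of_le (hmem i _ (le_max_right _ _)).1 n

theorem IsTRS.exists_forall_mem_finite (hS : S.IsTRS) {P : α → R → Prop}
    (hP : ∀ b D D', S.le D' D → P b D → P b D') {n j : ℕ}
    {D : R} (hstep : ∀ b ∈ S.ARn n, ∀ E, S.le E D → S.hasDepth E b → S.depth E b = j →
      ∃ E' ∈ S.segN j E, P b E') {T : Set α} (hT : T.Finite) :
    ∃ D' ∈ S.segN j D, ∀ b ∈ T, b ∈ S.ARn n → S.hasDepth D b → S.depth D b = j → P b D' := by
  induction T, hT using Set.Finite.induction_on with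
  | empty => exact ⟨D, S.self_mem_segN _ _, by simp⟩
  | @insert b T _ _ ih =>
    obtain ⟨D₁, hD₁, h₁⟩ := ih
    by_cases hb : b ∈ S.ARn n ∧ S.hasDepth D b ∧ S.depth D b = j
    · obtain ⟨hbn, hbd, hbj⟩ := hb
      obtain ⟨hd, he⟩ := hS.depth_eq_of_mem_segN hD₁ hbd hbj.le
      obtain ⟨D₂, hD₂, h₂⟩ := hstep b hbn D₁ hD₁.1 hd (he.trans hbj)
      refine ⟨D₂, hS.segN_trans hD₂ hD₁ le_rfl, ?_⟩
      rintro c (rfl | hc) hcn hcd hcj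
      · exact h₂
      · exact hP _ _ _ hD₂.1 (h₁ c hc hcn hcd hcj)
    · refine ⟨D₁, hD₁, ?_⟩
      rintro c (rfl | hc) hcn hcd hcj
      · exact absurd ⟨hcn, hcd, hcj⟩ hb
      · exact h₁ c hc hcn hcd hcj

/-- Fusion of a hereditary property over all approximations of a fixed length. -/
theorem IsTRS.exists_fusion (hS : S.IsTRS) {P : α → R → Prop}
    (hP : ∀ b D D', S.le D' D → P b D → P b D') {n N : ℕ} {D : R}
    (hstep : ∀ b ∈ S.ARn n, ∀ E, S.le E D → S.hasDepth E b → N ≤ S.depth E b →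
      ∃ E' ∈ S.segN (S.depth E b) E, P b E') :
    ∃ H ∈ S.segN N D, ∀ b ∈ S.ARn n, S.hasDepth H b → N ≤ S.depth H b → P b H := by
  have hone : ∀ (i : ℕ) (E : R), S.le E D → ∃ E' ∈ S.segN (N + i) E, ∀ b ∈ S.ARn n,
      S.hasDepth E b → S.depth E b = N + i → P b E' := by
    intro i E hED
    obtain ⟨E', hE', h⟩ := hS.exists_forall_mem_finite (j := N + i) hP (D := E)
      (fun b hb F hFE hd hj => by
        have := hstep b hb F (S.le_trans hFE hED) hd (by omega)
        rwa [hj] at this)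
      (hS.2.2.1.2.2.1 (S.r E (N + i)))
    exact ⟨E', hE', fun b hb hd hj => h b (by simpa [hj] using S.lefin_depth hd) hb hd hj⟩
  have : Nonempty R := ⟨D⟩
  choose! g hg hgP using hone
  let F : ℕ → R := Nat.rec D g
  have hF : ∀ i, S.le (F i) D := fun i => Nat.rec (S.le_refl D)
    (fun i ih => S.le_trans (hg i (F i) ih).1 ih) i
  obtain ⟨H, hH⟩ := hS.exists_fusion_limit (k := (N + ·)) (fun _ _ h => Nat.add_le_add_left h N)
    (fun n => ⟨n, Nat.le_add_left n N⟩) F fun i => hg i (F i) (hF i)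
  refine ⟨H, hH 0, fun b hb hd hN => ?_⟩
  obtain ⟨i, hi⟩ := Nat.exists_eq_add_of_le hN
  have hFb : S.lefin b (S.r (F i) (N + i)) := by
    rw [← (hH i).2, ← hi]
    exact S.lefin_depth hd
  obtain ⟨-, he⟩ := hS.depth_eq_of_mem_segN (hH i) ⟨_, hFb⟩ (S.depth_le hFb)
  exact hP _ _ _ (hH (i + 1)).1 (hgP i (F i) (hF i) b hb ⟨_, hFb⟩ (he ▸ hi))

theorem IsTRS.depth_mono (hS : S.IsTRS) {b c : α} (h : S.Init b c) {B : R}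
    (hc : S.hasDepth B c) : S.hasDepth B b ∧ S.depth B b ≤ S.depth B c := by
  obtain ⟨d, ⟨C, n, m, hnm, rfl, hm⟩, hbd⟩ := hS.2.2.1.2.2.2.2 b c _ h (S.lefin_depth hc)
  obtain rfl := hS.r_injective hm
  rw [hS.r_eq_of_le hm hnm] at hbd
  exact ⟨⟨_, hbd⟩, (S.depth_le hbd).trans hnm⟩

variable (S)

/-! ### Positions of the game that are consistent with a strategy of player I -/

/-- `p` lists moves of player II which are legal when player I follows `σ`. -/
def Legal (na : ℕ) (σ : List (α × R) → R) (p : List (α × R)) : Prop :=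
  ∀ (i : ℕ) (h : i < p.length), S.le p[i].2 (σ (p.take i)) ∧
    S.r p[i].2 (na + i) = S.r (σ (p.take i)) (na + i) ∧ S.r p[i].2 (na + i + 1) = p[i].1

theorem legal_nil (na : ℕ) (σ : List (α × R) → R) : S.Legal na σ [] :=
  fun _ h => absurd h (Nat.not_lt_zero _)

variable {S}

theorem Legal.of_prefix {na : ℕ} {σ : List (α × R) → R} {p q : List (α × R)}
    (hq : S.Legal na σ q) (h : p <+: q) : S.Legal na σ p := by
  obtain ⟨t, rfl⟩ := h
  intro i hi
  have := hq i (by simp; omega)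
  rwa [List.getElem_append_left hi, List.take_append_of_le_length hi.le] at this

theorem Legal.snoc {na : ℕ} {σ : List (α × R) → R} {p : List (α × R)} (hp : S.Legal na σ p)
    {B : R} (hB : B ∈ S.segN (na + p.length) (σ p)) :
    S.Legal na σ (p ++ [(S.r B (na + p.length + 1), B)]) := by
  intro i hi
  rcases Nat.lt_or_ge i p.length with h | h
  · rw [List.getElem_append_left h, List.take_append_of_le_length h.le]
    exact hp i h
  · obtain rfl : i = p.length := by simp at hi; omega
    simpa [segN, seg] using hB

theorem take_ofFn {β : Type} (m : ℕ → β) {k n : ℕ} (h : k ≤ n) :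
    (List.ofFn fun i : Fin n => m i.1).take k = List.ofFn fun i : Fin k => m i.1 :=
  List.ext_getElem (by simpa using h) (by simp)

theorem IWinning.ruleII_of_legal {X : Set R} {a : α} {na : ℕ} {A : R} {σ : List (α × R) → R}
    (hS : S.IsTRS) (hσ : S.IWinning X a na A σ) {ak : ℕ → α} {Bk : ℕ → R} (ha : ak 0 = a)
    (hA : Bk 0 = A) {k : ℕ}
    (h : S.Legal na σ (List.ofFn fun i : Fin k => (ak (i.1 + 1), Bk (i.1 + 1)))) :
    ∀ i < k, S.ruleII na ak Bk (playI σ ak Bk) i := by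
  intro i
  induction i using Nat.strong_induction_on with
  | _ i ih =>
    intro hi
    obtain ⟨-, hI⟩ := hσ.1 ak Bk ha hA i fun j hj => ih j hj (hj.trans hi)
    obtain ⟨h1, h2, h3⟩ := h i (by simpa using hi)
    rw [take_ofFn (fun i => (ak (i + 1), Bk (i + 1))) hi.le] at h1 h2
    simp only [List.getElem_ofFn] at h1 h2 h3
    refine ⟨⟨Bk (i + 1), h2.trans hI, h3⟩, ?_, h1, h3⟩
    rw [← h3, ← hI]
    intro he
    have := hS.r_injective he
    omega

theorem IWinning.response_nil {X : Set R} {a : α} {na : ℕ} {A : R} {σ : List (α × R) → R}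
    (hσ : S.IWinning X a na A σ) : σ [] ∈ S.seg a na A :=
  hσ.1 (fun _ => a) (fun _ => A) rfl rfl 0 (by simp)

theorem IWinning.response_snoc {X : Set R} {a : α} {na : ℕ} {A : R} {σ : List (α × R) → R}
    (hS : S.IsTRS) (hσ : S.IWinning X a na A σ) {p : List (α × R)} {c : α} {B : R}
    (hp : S.Legal na σ (p ++ [(c, B)])) :
    σ (p ++ [(c, B)]) ∈ S.seg c (na + p.length + 1) B := by
  set q := p ++ [(c, B)] with hq
  let ak : ℕ → α := fun i => Nat.casesOn i a fun j => (q.getD j (a, A)).1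
  let Bk : ℕ → R := fun i => Nat.casesOn i A fun j => (q.getD j (a, A)).2
  have hof : (List.ofFn fun i : Fin q.length => (ak (i.1 + 1), Bk (i.1 + 1))) = q :=
    List.ext_getElem (by simp) fun i h1 h2 => by simp [ak, Bk]
  have hI := hσ.1 ak Bk rfl rfl q.length
    (hσ.ruleII_of_legal hS (ak := ak) (Bk := Bk) rfl rfl (by rwa [hof]))
  unfold ruleI playI at hI
  rw [hof] at hI
  have hlen : q.length = p.length + 1 := by simp [hq]
  have ha : ak q.length = c := by simp [ak, hq]
  have hB : Bk q.length = B := by simp [Bk, hq]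
  rw [ha, hB, hlen] at hI
  exact hI

/-- A legal extension of a legal position by an object `B`, together with player I's answer. -/
theorem IWinning.extend {X : Set R} {a : α} {na : ℕ} {A : R} {σ : List (α × R) → R}
    (hS : S.IsTRS) (hσ : S.IWinning X a na A σ) {p : List (α × R)} (hp : S.Legal na σ p)
    {B : R} (hB : B ∈ S.segN (na + p.length) (σ p)) :
    ∃ q, p <+: q ∧ S.Legal na σ q ∧ q.length = p.length + 1 ∧
      σ q ∈ S.segN (na + q.length) B := by
  have h := hp.snoc hB
  refine ⟨_, List.prefix_append _ _, h, by simp, ?_⟩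
  have := hσ.response_snoc hS h
  rw [List.length_append, List.length_singleton]
  exact this

/-- The moves in a legal position are the approximations of player I's answer. -/
theorem IWinning.fst_getElem {X : Set R} {a : α} {na : ℕ} {A : R} {σ : List (α × R) → R}
    (hS : S.IsTRS) (hσ : S.IWinning X a na A σ) {p : List (α × R)} (hp : S.Legal na σ p) {C : R}
    (hC : S.r (σ p) (na + p.length) = S.r C (na + p.length)) :
    ∀ (i : ℕ) (h : i < p.length), p[i].1 = S.r C (na + i + 1) := by
  induction p using List.reverseRecOn with
  | nil => simp
  | append_singleton p x ih =>
    obtain ⟨c, B⟩ := x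
    have hsn := (hσ.response_snoc hS hp).2
    obtain ⟨-, h2, h3⟩ := hp p.length (by simp)
    simp only [List.getElem_concat_length, List.take_left'] at h2 h3
    rw [List.length_append, List.length_singleton, ← add_assoc] at hC
    have hBC : S.r B (na + p.length + 1) = S.r C (na + p.length + 1) :=
      h3.trans (hsn.symm.trans hC)
    intro i hi
    rcases Nat.lt_or_ge i p.length with h | h
    · rw [List.getElem_append_left h]
      exact ih (hp.of_prefix (List.prefix_append _ _))
        (h2.symm.trans (hS.r_eq_of_le hBC (by omega))) i h
    · obtain rfl : i = p.length := by simp at hi; omega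
      simpa using h3.symm.trans hBC

/-- An object all of whose approximations are produced by longer and longer legal positions
belongs to the payoff set. -/
theorem IWinning.mem_of_chain {X : Set R} {a : α} {na : ℕ} {A : R} {σ : List (α × R) → R}
    (hS : S.IsTRS) (hσ : S.IWinning X a na A σ) {C : R} (hC : S.r C na = a)
    {p : ℕ → List (α × R)} (hp : ∀ n, p n <+: p (n + 1)) (hlen : ∀ k, ∃ n, k < (p n).length)
    (hleg : ∀ n, ∃ q, p n <+: q ∧ S.Legal na σ q ∧
      S.r (σ q) (na + q.length) = S.r C (na + q.length)) : C ∈ X := by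
  have hmono : ∀ {n n'}, n ≤ n' → p n <+: p n' := fun {n n'} h => by
    induction n', h using Nat.le_induction with
    | base => exact List.prefix_rfl
    | succ n' _ ih => exact ih.trans (hp n')
  choose f hf using hlen
  let m : ℕ → α × R := fun i => (p (f i))[i]'(hf i)
  have hm : ∀ n i (h : i < (p n).length), (p n)[i] = m i := fun n i h => by
    rcases le_total n (f i) with h' | h'
    · exact (hmono h').getElem h
    · exact ((hmono h').getElem (hf i)).symm
  have hpre : ∀ k, (List.ofFn fun i : Fin k => m i.1) <+: p (f k) := fun k =>
    List.prefix_iff_getElem.2 ⟨by simpa using (hf k).le, fun i hi => by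
      rw [List.getElem_ofFn, hm]⟩
  have hmC : ∀ i, (m i).1 = S.r C (na + i + 1) := fun i => by
    obtain ⟨q, hpq, hq, hqC⟩ := hleg (f i)
    have := hσ.fst_getElem hS hq hqC i ((hf i).trans_le hpq.length_le)
    rwa [← hpq.getElem (hf i)] at this
  let ak : ℕ → α := fun i => Nat.casesOn i a fun j => (m j).1
  let Bk : ℕ → R := fun i => Nat.casesOn i A fun j => (m j).2
  have hII : ∀ k, S.ruleII na ak Bk (playI σ ak Bk) k := fun k => by
    obtain ⟨q, hpq, hq, -⟩ := hleg (f (k + 1))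
    exact hσ.ruleII_of_legal hS (ak := ak) (Bk := Bk) (k := k + 1) rfl rfl
      (hq.of_prefix ((hpre (k + 1)).trans hpq)) k (Nat.lt_succ_self k)
  have hak : ∀ k, S.r C (na + k) = ak k := fun k => by
    cases k with
    | zero => exact hC
    | succ k => exact (hmC k).symm
  refine hσ.2 ak Bk rfl rfl (fun k => ⟨hσ.1 ak Bk rfl rfl k fun i _ => hII i, hII k⟩) C ?_
  ext Y
  simp only [Set.mem_singleton_iff, Set.mem_iInter, Set.mem_ofPred_eq]
  refine ⟨fun h k => h ▸ hak k, fun h => hS.ext_of_r fun n => ?_⟩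
  exact hS.r_eq_of_le ((h n).trans (hak n).symm) (Nat.le_add_left n na)

variable (S)

/-! ### Controlling the next approximation -/

/-- Below every member of `[b, D]`, player I can be led to answer a legal position at `b` that
extends `p`. -/
def Reaches (na : ℕ) (σ : List (α × R) → R) (b : α) (nb : ℕ) (p : List (α × R)) (D : R) : Prop :=
  ∀ E ∈ S.seg b nb D, ∃ q, p <+: q ∧ S.Legal na σ q ∧ na + q.length = nb ∧ σ q ∈ S.seg b nb E

/-- Every member of `[c, D]`, where `|c| = nb + 1`, is a legal next object at the position `p`. -/
def Dominates (na : ℕ) (σ : List (α × R) → R) (c : α) (nb : ℕ) (p : List (α × R)) (D : R) :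
    Prop :=
  S.Legal na σ p ∧ na + p.length = nb ∧ ∀ E ∈ S.seg c (nb + 1) D, E ∈ S.segN nb (σ p)

/-- Every one-step extension `c` of `b` below `D` is reached over `φ' c`, which extends `p`;
moreover `φ' c` is a position at `b`, unless the one-step extension is unique. -/
def Controls (na : ℕ) (σ : List (α × R) → R) (b : α) (m : ℕ) (p : List (α × R))
    (φ' : α → List (α × R)) (D : R) : Prop :=
  ∀ c ∈ S.rimg (m + 1) b m D, p <+: φ' c ∧ S.Reaches na σ c (m + 1) (φ' c) D ∧
    ((S.rimg (m + 1) b m D).Subsingleton ∨ na + (φ' c).length = m)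

variable {S}

theorem Reaches.mono {na : ℕ} {σ : List (α × R) → R} {b : α} {nb : ℕ} {p : List (α × R)}
    {D D' : R} (h : S.Reaches na σ b nb p D) (hD : S.le D' D) : S.Reaches na σ b nb p D' :=
  fun E hE => h E (S.seg_mono hD b nb hE)

theorem Dominates.mono {na : ℕ} {σ : List (α × R) → R} {c : α} {nb : ℕ} {p : List (α × R)}
    {D D' : R} (h : S.Dominates na σ c nb p D) (hD : S.le D' D) : S.Dominates na σ c nb p D' :=
  ⟨h.1, h.2.1, fun E hE => h.2.2 E (S.seg_mono hD c (nb + 1) hE)⟩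

theorem Controls.mono {na : ℕ} {σ : List (α × R) → R} {b : α} {m : ℕ} {p : List (α × R)}
    {φ' : α → List (α × R)} {D D' : R} (h : S.Controls na σ b m p φ' D) (hD : S.le D' D) :
    S.Controls na σ b m p φ' D' := fun c hc =>
  have hsub := S.rimg_mono hD b m (m + 1)
  have hc := h c (hsub hc)
  ⟨hc.1, hc.2.1.mono hD, hc.2.2.imp_left fun h => h.anti hsub⟩

theorem Dominates.reaches {X : Set R} {a : α} {na : ℕ} {A : R} {σ : List (α × R) → R}
    (hS : S.IsTRS) (hσ : S.IWinning X a na A σ) {c : α} {nb : ℕ} {p : List (α × R)} {D : R}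
    (h : S.Dominates na σ c nb p D) : S.Reaches na σ c (nb + 1) p D := by
  obtain ⟨hp, rfl, h⟩ := h
  intro E hE
  obtain ⟨q, hpq, hq, hlen, hqE⟩ := hσ.extend hS hp (h E hE)
  rw [hlen, ← add_assoc] at hqE
  exact ⟨q, hpq, hq, by omega, hqE.1, hqE.2.trans hE.2⟩

theorem IsTRS.pigeonhole (hS : S.IsTRS) {b : α} {n k : ℕ} (hb : b ∈ S.ARn n) {D : R}
    (hd : S.hasDepth D b) (hk : S.depth D b = k) (O : Set α) :
    ∃ D' ∈ S.segN k D, S.rimg (n + 1) b n D' ⊆ O ∨ Disjoint O (S.rimg (n + 1) b n D') := by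
  obtain ⟨D', hD', h⟩ := hS.2.2.2.2 b n hb D hd (O ∩ S.ARn (n + 1)) Set.inter_subset_right
  refine ⟨D', hk ▸ hD', h.imp (fun h => h.trans Set.inter_subset_left) fun h => ?_⟩
  rw [Set.disjoint_left]
  rintro c hcO ⟨E, hE, rfl⟩
  exact h.subset ⟨⟨hcO, E, rfl⟩, E, hE, rfl⟩

theorem IsTRS.exists_subsingleton_rimg (hS : S.IsTRS) {b : α} {n k : ℕ} (hb : b ∈ S.ARn n)
    {T : Set α} (hT : T.Finite) {D : R} (hd : S.hasDepth D b) (hk : S.depth D b = k)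
    (hDT : S.rimg (n + 1) b n D ⊆ T) :
    ∃ D' ∈ S.segN k D, (S.rimg (n + 1) b n D').Subsingleton := by
  induction T, hT using Set.Finite.induction_on generalizing D with
  | empty => exact ⟨D, S.self_mem_segN _ _, Set.subsingleton_empty.anti hDT⟩
  | @insert c T _ _ ih =>
    obtain ⟨D₁, hD₁, h | h⟩ := hS.pigeonhole hb hd hk {c}
    · exact ⟨D₁, hD₁, Set.subsingleton_singleton.anti h⟩
    · obtain ⟨hd₁, hk₁⟩ := hS.depth_eq_of_mem_segN hD₁ hd hk.le
      obtain ⟨D₂, hD₂, h₂⟩ := ih hd₁ (hk₁.trans hk) fun x hx =>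
        (hDT (S.rimg_mono hD₁.1 b n (n + 1) hx)).resolve_left fun hxc =>
          Set.disjoint_left.1 h hxc hx
      exact ⟨D₂, hS.segN_trans hD₂ hD₁ le_rfl, h₂⟩

/-- If `D` reaches `b` over `p`, then some `D' ∈ [depth_D(b), D]` either has a unique
one-step extension of `b`, or all of its one-step extensions are controlled by legal positions
at `b` extending `p`. -/
theorem IWinning.exists_control {X : Set R} {a : α} {na : ℕ} {A : R} {σ : List (α × R) → R}
    (hS : S.IsTRS) (hσ : S.IWinning X a na A σ) {b : α} {n : ℕ} (hb : b ∈ S.ARn n)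
    {p : List (α × R)} {D : R} (hd : S.hasDepth D b) (h : S.Reaches na σ b n p D) :
    ∃ D' ∈ S.segN (S.depth D b) D, ∃ ψ, S.Controls na σ b n p ψ D' := by
  set k := S.depth D b with hk
  let Ctrl : α → R → Prop := fun c E => ∃ q, p <+: q ∧ S.Dominates na σ c n q E
  have hCtrl : ∀ c E E', S.le E' E → Ctrl c E → Ctrl c E' :=
    fun c E E' hE ⟨q, hpq, hq⟩ => ⟨q, hpq, hq.mono hE⟩
  let P : α → R → Prop := fun c E => (∃ F ∈ S.seg c (n + 1) E, ∃ q, p <+: q ∧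
    S.Legal na σ q ∧ na + q.length = n ∧ F ∈ S.segN n (σ q)) → Ctrl c E
  have hP : ∀ c E E', S.le E' E → P c E → P c E' := fun c E E' hE hc ⟨F, hF, hF'⟩ =>
    hCtrl c E E' hE (hc ⟨F, S.seg_mono hE c (n + 1) hF, hF'⟩)
  obtain ⟨D₁, hD₁, h₁⟩ : ∃ D₁ ∈ S.segN (max k (n + 1)) D, ∀ c ∈ S.ARn (n + 1),
      S.hasDepth D₁ c → max k (n + 1) ≤ S.depth D₁ c → P c D₁ := by
    refine hS.exists_fusion hP fun c hc E _ hE hN => ?_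
    by_cases hex : ∃ F ∈ S.seg c (n + 1) E, ∃ q, p <+: q ∧ S.Legal na σ q ∧
      na + q.length = n ∧ F ∈ S.segN n (σ q)
    · obtain ⟨F, hF, q, hpq, hq, hqn, hFq⟩ := hex
      have hcF : S.lefin c (S.r F (n + 1)) := by
        have := hS.lefin_self F (n + 1)
        rwa [hF.2] at this ⊢
      obtain ⟨E', hE', hsub⟩ := hS.2.2.2.1.2 c (n + 1) hc F E hF.1 hE ⟨_, hcF⟩
        ((S.depth_le hcF).trans ((le_max_right _ _).trans hN))
      refine ⟨E', hE', fun _ => ⟨q, hpq, hq, hqn, fun G hG => ?_⟩⟩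
      have hGF := hsub hG
      exact ⟨S.le_trans hGF.1 hFq.1,
        (hS.r_eq_of_le (hGF.2.trans hF.2.symm) n.le_succ).trans hFq.2⟩
    · exact ⟨E, S.self_mem_segN _ _, fun h => absurd h hex⟩
  have hD₁k := hS.segN_trans hD₁ (S.self_mem_segN k D) (le_max_left _ _)
  obtain ⟨hd₁, hk₁⟩ := hS.depth_eq_of_mem_segN hD₁k hd hk.ge
  obtain ⟨D₂, hD₂, h₂ | h₂⟩ := hS.pigeonhole hb hd₁ (hk₁.trans hk.symm) {c | Ctrl c D₁}
  · choose! ψ hψ using h₂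
    exact ⟨D₂, hS.segN_trans hD₂ hD₁k le_rfl, ψ, fun c hc => ⟨(hψ hc).1,
      ((hψ hc).2.mono hD₂.1).reaches hS hσ, Or.inr (hψ hc).2.2.1⟩⟩
  · have hD₂k := hS.segN_trans hD₂ hD₁k le_rfl
    obtain ⟨hd₂, hk₂⟩ := hS.depth_eq_of_mem_segN hD₂k hd hk.ge
    let T : Set α := ⋃ j ∈ Set.Iio (max k (n + 1)), {c | S.lefin c (S.r D₁ j)}
    have hT : T.Finite := (Set.finite_Iio _).biUnion fun j _ => hS.2.2.1.2.2.1 _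
    obtain ⟨D₃, hD₃, h₃⟩ := hS.pigeonhole hb hd₂ (hk₂.trans hk.symm) T
    have hD₃k := hS.segN_trans hD₃ hD₂k le_rfl
    obtain ⟨hd₃, hk₃⟩ := hS.depth_eq_of_mem_segN hD₃k hd hk.ge
    have hsub : S.rimg (n + 1) b n D₃ ⊆ T := by
      refine h₃.resolve_right fun hdis => ?_
      obtain ⟨E, hE⟩ := hS.seg_nonempty hb hd₃
      obtain ⟨q, hpq, hq, hqn, hqE⟩ := h E (S.seg_mono hD₃k.1 b n hE)
      have hq₃ : σ q ∈ S.seg b n D₃ := S.seg_mono hE.1 b n hqE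
      have hq₂ := S.seg_mono hD₃.1 b n hq₃
      have hq₁ := S.seg_mono hD₂.1 b n hq₂
      have hdc := hS.hasDepth_of_le hq₁.1 (n + 1)
      refine Set.disjoint_left.1 h₂ (h₁ _ ⟨σ q, rfl⟩ hdc ?_ ?_) ⟨σ q, hq₂, rfl⟩
      · by_contra hlt
        exact Set.disjoint_left.1 hdis (Set.mem_biUnion (not_le.1 hlt) (S.lefin_depth hdc))
          ⟨σ q, hq₃, rfl⟩
      · exact ⟨σ q, ⟨hq₁.1, rfl⟩, q, hpq, hq, hqn, S.self_mem_segN _ _⟩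
    obtain ⟨D₄, hD₄, h₄⟩ := hS.exists_subsingleton_rimg hb hT hd₃ (hk₃.trans hk.symm) hsub
    have hD₄k := hS.segN_trans hD₄ hD₃k le_rfl
    refine ⟨D₄, hD₄k, fun _ => p, fun c hc => ⟨List.prefix_rfl, ?_, Or.inl h₄⟩⟩
    obtain ⟨C, hC, hCc⟩ := id hc
    intro E hE
    have hEb : E ∈ S.seg b n D₄ :=
      ⟨hE.1, (hS.r_eq_of_le (hE.2.trans hCc.symm) n.le_succ).trans hC.2⟩
    obtain ⟨q, hpq, hq, hqn, hqE⟩ := h E (S.seg_mono hD₄k.1 b n hEb)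
    have hqc : S.r (σ q) (n + 1) = c :=
      h₄ ⟨σ q, S.seg_mono hEb.1 b n hqE, rfl⟩ hc
    obtain ⟨q', hqq', hq', hlen, hqE'⟩ := hσ.extend hS hq (S.self_mem_segN _ _)
    rw [hlen, ← add_assoc, hqn] at hqE'
    exact ⟨q', hpq.trans hqq', hq', by omega, S.le_trans hqE'.1 hqE.1, hqE'.2.trans hqc⟩

variable (S)

/-! ### Controlling all approximations -/

/-- The approximations of length `m` of objects extending `a`. -/
def extensions (a : α) (na m : ℕ) : Set α := {b | ∃ C, S.r C na = a ∧ S.r C m = b}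

/-- The least depth in `D` of an approximation of length `m` extending `a`. -/
noncomputable def minDepth (a : α) (na m : ℕ) (D : R) : ℕ :=
  sInf {d | ∃ b ∈ S.extensions a na m, S.hasDepth D b ∧ S.depth D b = d}

variable {S}

theorem minDepth_le {a b : α} {na m : ℕ} {D : R} (hb : b ∈ S.extensions a na m)
    (hd : S.hasDepth D b) : S.minDepth a na m D ≤ S.depth D b :=
  Nat.sInf_le ⟨b, hb, hd, rfl⟩

theorem IsTRS.exists_depth_eq_minDepth (hS : S.IsTRS) {a : α} {na : ℕ} (ha : a ∈ S.ARn na)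
    {D : R} (hd : S.hasDepth D a) (m : ℕ) :
    ∃ b ∈ S.extensions a na m, S.hasDepth D b ∧ S.depth D b = S.minDepth a na m D := by
  obtain ⟨C, hC⟩ := hS.seg_nonempty ha hd
  exact Nat.sInf_mem (s := {d | ∃ b ∈ S.extensions a na m, S.hasDepth D b ∧ S.depth D b = d})
    ⟨_, S.r C m, ⟨C, hC.2, rfl⟩, hS.hasDepth_of_le hC.1 m, rfl⟩

theorem IWinning.exists_controls {X : Set R} {a : α} {na : ℕ} {A : R} {σ : List (α × R) → R}
    (hS : S.IsTRS) (hσ : S.IWinning X a na A σ) {m : ℕ} {D : R} {φ : α → List (α × R)}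
    (h : ∀ b ∈ S.extensions a na m, S.hasDepth D b → S.Reaches na σ b m (φ b) D) :
    ∃ D' ∈ S.segN (S.minDepth a na m D) D, ∃ φ' : α → List (α × R),
      ∀ b ∈ S.extensions a na m, S.Controls na σ b m (φ b) φ' D' := by
  obtain ⟨H, hH, hHP⟩ := hS.exists_fusion (n := m) (D := D) (N := S.minDepth a na m D)
    (P := fun b E => b ∈ S.extensions a na m → ∃ ψ, S.Controls na σ b m (φ b) ψ E)
    (fun b E E' hE hb hbm => (hb hbm).imp fun ψ hψ => hψ.mono hE)
    (fun b hb E hED hd _ => by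
      by_cases hbm : b ∈ S.extensions a na m
      · obtain ⟨E', hE', ψ, hψ⟩ := hσ.exists_control hS hb hd
          ((h b hbm (hS.hasDepth_mono hED hd)).mono hED)
        exact ⟨E', hE', fun _ => ⟨ψ, hψ⟩⟩
      · exact ⟨E, S.self_mem_segN _ _, fun h => absurd h hbm⟩)
  have hψ : ∀ b ∈ S.extensions a na m, ∃ ψ, S.Controls na σ b m (φ b) ψ H := by
    intro b hb
    by_cases hd : S.hasDepth H b
    · obtain ⟨C, hC, rfl⟩ := id hb
      exact hHP _ ⟨C, rfl⟩ hd (hS.le_depth_of_mem_segN hH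
        (minDepth_le hb (hS.hasDepth_mono hH.1 hd)) hd) hb
    · refine ⟨fun _ => [], fun c hc => ?_⟩
      obtain ⟨E, ⟨hEH, rfl⟩, -⟩ := hc
      exact absurd (hS.hasDepth_of_le hEH m) hd
  choose! ψ hψ using hψ
  have hφ : ∀ c, ∃ p, ∀ b ∈ S.extensions a na m, c ∈ S.rimg (m + 1) b m H → p = ψ b c := by
    intro c
    by_cases hc : ∃ b, c ∈ S.rimg (m + 1) b m H
    · obtain ⟨b, E, hE, rfl⟩ := hc
      refine ⟨ψ b (S.r E (m + 1)), ?_⟩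
      rintro b' - ⟨E', hE', he⟩
      rw [← hE.2, ← hE'.2, hS.r_eq_of_le he m.le_succ]
    · exact ⟨[], fun b _ hb => absurd ⟨b, hb⟩ hc⟩
  choose φ' hφ' using hφ
  refine ⟨H, hH, φ', fun b hb c hc => ?_⟩
  rw [hφ' c b hb hc]
  exact hψ b hb c hc

/-- The outcome of the fusion: a single object below which all approximations are controlled. -/
theorem IWinning.exists_forall_controls {X : Set R} {a : α} {na : ℕ} {A : R}
    {σ : List (α × R) → R} (hS : S.IsTRS) (hσ : S.IWinning X a na A σ) (ha : a ∈ S.ARn na) :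
    ∃ H ∈ S.seg a na A, ∃ φ : ℕ → α → List (α × R), ∀ i,
      ∀ b ∈ S.extensions a na (na + 1 + i),
        (S.hasDepth H b → S.Reaches na σ b (na + 1 + i) (φ i b) H) ∧
        S.Controls na σ b (na + 1 + i) (φ i b) (φ (i + 1)) H := by
  let Inv : ℕ → R × (α → List (α × R)) → Prop := fun i s => S.hasDepth s.1 a ∧
    ∀ b ∈ S.extensions a na (na + 1 + i), S.hasDepth s.1 b →
      S.Reaches na σ b (na + 1 + i) (s.2 b) s.1
  have hstep : ∀ i s, Inv i s → ∃ t, Inv (i + 1) t ∧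
      t.1 ∈ S.segN (S.minDepth a na (na + 1 + i) s.1) s.1 ∧
      ∀ b ∈ S.extensions a na (na + 1 + i),
        S.Controls na σ b (na + 1 + i) (s.2 b) t.2 t.1 := by
    rintro i ⟨D, φ⟩ ⟨hda, hD⟩
    obtain ⟨D', hD', φ', hφ'⟩ := hσ.exists_controls hS hD
    refine ⟨(D', φ'), ⟨?_, fun c hc hdc => ?_⟩, hD', hφ'⟩
    · obtain ⟨b, ⟨C, hC, rfl⟩, hdb, hb⟩ := hS.exists_depth_eq_minDepth ha hda (na + 1 + i)
      refine (hS.depth_eq_of_mem_segN hD' hda ?_).1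
      rw [← hb]
      exact (hS.depth_mono ⟨C, na, na + 1 + i, by omega, hC, rfl⟩ hdb).2
    · obtain ⟨C, hC, rfl⟩ := hc
      obtain ⟨E, hE⟩ := hS.seg_nonempty ⟨C, rfl⟩ hdc
      have hEC : S.r E (na + 1 + i) = S.r C (na + 1 + i) := hS.r_eq_of_le hE.2 (by omega)
      exact (hφ' (S.r C (na + 1 + i)) ⟨C, hC, rfl⟩ _ ⟨E, ⟨hE.1, hEC⟩, hE.2⟩).2.1
  have hnil := hσ.response_nil
  have h0 : Inv 0 (σ [], fun _ => []) := by
    refine ⟨by simpa [hnil.2] using hS.hasDepth_of_le (S.le_refl (σ [])) na, ?_⟩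
    rintro b ⟨C, hC, rfl⟩ -
    refine Dominates.reaches hS hσ ⟨S.legal_nil na σ, rfl, fun E hE => ⟨hE.1, ?_⟩⟩
    rw [hS.r_eq_of_le hE.2 na.le_succ, hC, hnil.2]
  have : Nonempty (R × (α → List (α × R))) := ⟨(σ [], fun _ => [])⟩
  choose! g hgInv hgD hgC using hstep
  let F : ℕ → R × (α → List (α × R)) := Nat.rec (σ [], fun _ => []) g
  have hF : ∀ i, Inv i (F i) := fun i => Nat.rec h0 (fun i ih => hgInv i _ ih) i
  let k : ℕ → ℕ := fun i => S.minDepth a na (na + 1 + i) (F i).1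
  have hD : ∀ i, (F (i + 1)).1 ∈ S.segN (k i) (F i).1 := fun i => hgD i _ (hF i)
  choose b hb hbd hbk using fun i => hS.exists_depth_eq_minDepth ha (hF i).1 (na + 1 + i)
  have hk : Monotone k := monotone_nat_of_le_succ fun i => by
    obtain ⟨C, hC, hCb⟩ := hb (i + 1)
    obtain ⟨hd, hle⟩ := hS.depth_mono ⟨C, na + 1 + i, _, by omega, rfl, hCb⟩ (hbd (i + 1))
    exact (hS.le_depth_of_mem_segN (hD i)
      (minDepth_le ⟨C, hC, rfl⟩ (hS.hasDepth_mono (hD i).1 hd)) hd).trans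
      (hle.trans (hbk (i + 1)).le)
  have hinj : Function.Injective b := fun i j hij => by
    obtain ⟨C, -, hC⟩ := hb i
    obtain ⟨C', -, hC'⟩ := hb j
    have := hS.r_injective ((hC.trans hij).trans hC'.symm)
    omega
  obtain ⟨H, hH⟩ := hS.exists_fusion_limit hk (hS.exists_le_of_injective hk hD hinj
    fun i => by simpa only [hbk] using S.lefin_depth (hbd i)) _ hD
  have hda : S.hasDepth H a := by
    obtain ⟨C, hC, hCb⟩ := hb 0
    refine (hS.depth_eq_of_mem_segN (hH 0) (hF 0).1 ?_).1
    exact (hS.depth_mono ⟨C, na, _, by omega, hC, hCb⟩ (hbd 0)).2.trans (hbk 0).le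
  obtain ⟨H', hH'⟩ := hS.seg_nonempty ha hda
  refine ⟨H', ⟨S.le_trans hH'.1 (S.le_trans (hH 0).1 hnil.1), hH'.2⟩, fun i => (F i).2,
    fun i b hb => ⟨fun hd => ?_, (hgC i _ (hF i) b hb).mono (S.le_trans hH'.1 (hH (i + 1)).1)⟩⟩
  have hle := S.le_trans hH'.1 (hH i).1
  exact ((hF i).2 b hb (hS.hasDepth_mono hle hd)).mono hle

/-- If `C` is the only object in `[b, H]`, then a legal position answered by `C` can be prolonged
forever. -/
theorem IWinning.mem_of_seg_subsingleton {X : Set R} {a : α} {na : ℕ} {A : R}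
    {σ : List (α × R) → R} (hS : S.IsTRS) (hσ : S.IWinning X a na A σ) {b : α} {C H : R}
    {q : List (α × R)} (hCa : S.r C na = a) (hb : ∀ E ∈ S.seg b (na + q.length) H, E = C)
    (hC : C ∈ S.seg b (na + q.length) H) (hq : S.Legal na σ q) (hqC : σ q = C) : C ∈ X := by
  have hstep : ∀ p, q <+: p ∧ S.Legal na σ p ∧ σ p = C →
      ∃ p', (q <+: p' ∧ S.Legal na σ p' ∧ σ p' = C) ∧ p <+: p' ∧ p'.length = p.length + 1 := by
    rintro p ⟨hqp, hp, hpC⟩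
    obtain ⟨p', hpp', hp', hlen, hp'C⟩ := hσ.extend hS hp (S.self_mem_segN _ (σ p))
    rw [hpC] at hp'C
    have hle := (hqp.trans hpp').length_le
    exact ⟨p', ⟨hqp.trans hpp', hp', hb _ ⟨S.le_trans hp'C.1 hC.1,
      (hS.r_eq_of_le hp'C.2 (by omega)).trans hC.2⟩⟩, hpp', hlen⟩
  choose! g hg hgp hglen using hstep
  let p : ℕ → List (α × R) := Nat.rec q fun _ => g
  have hp : ∀ n, q <+: p n ∧ S.Legal na σ (p n) ∧ σ (p n) = C := fun n =>
    Nat.rec ⟨List.prefix_rfl, hq, hqC⟩ (fun n ih => hg _ ih) n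
  have hlen : ∀ n, n ≤ (p n).length := fun n =>
    Nat.rec (Nat.zero_le _) (fun n ih => (Nat.succ_le_succ ih).trans (hglen _ (hp n)).ge) n
  exact hσ.mem_of_chain hS hCa (p := p) (fun n => hgp _ (hp n)) (fun k => ⟨k + 1, hlen (k + 1)⟩)
    fun n => ⟨p n, List.prefix_rfl, (hp n).2.1, by rw [(hp n).2.2]⟩

theorem IWinning.exists_seg_subset {X : Set R} {a : α} {na : ℕ} {A : R}
    {σ : List (α × R) → R} (hS : S.IsTRS) (hσ : S.IWinning X a na A σ) (ha : a ∈ S.ARn na) :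
    ∃ H ∈ S.seg a na A, S.seg a na H ⊆ X := by
  obtain ⟨H, hH, φ, hφ⟩ := hσ.exists_forall_controls hS ha
  refine ⟨H, hH, fun C hC => ?_⟩
  let b : ℕ → α := fun i => S.r C (na + 1 + i)
  have hb : ∀ i, b i ∈ S.extensions a na (na + 1 + i) := fun i => ⟨C, hC.2, rfl⟩
  have hreach : ∀ i, ∃ q, φ i (b i) <+: q ∧ S.Legal na σ q ∧ na + q.length = na + 1 + i ∧
      σ q ∈ S.seg (b i) (na + 1 + i) C := fun i =>
    (hφ i (b i) (hb i)).1 (hS.hasDepth_of_le hC.1 _) C ⟨hC.1, rfl⟩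
  have hctrl := fun i => (hφ i (b i) (hb i)).2 (b (i + 1)) ⟨C, ⟨hC.1, rfl⟩, rfl⟩
  by_cases hinf : ∀ k, ∃ i, k ≤ i ∧ na + (φ (i + 1) (b (i + 1))).length = na + 1 + i
  · refine hσ.mem_of_chain hS hC.2 (p := fun i => φ i (b i)) (fun i => (hctrl i).1) (fun k => ?_)
      fun i => ?_
    · obtain ⟨i, hki, hi⟩ := hinf k
      exact ⟨i + 1, by omega⟩
    · obtain ⟨q, hpq, hq, hlen, hqC⟩ := hreach i
      exact ⟨q, hpq, hq, by rw [hlen, hqC.2]⟩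
  · push Not at hinf
    obtain ⟨k, hk⟩ := hinf
    have hsub : ∀ i, k ≤ i → (S.rimg (na + 1 + i + 1) (b i) (na + 1 + i) H).Subsingleton :=
      fun i hi => (hctrl i).2.2.resolve_right (hk i hi)
    have huniq : ∀ E ∈ S.seg (b k) (na + 1 + k) H, E = C := by
      intro E hE
      have hEC : ∀ i, k ≤ i → S.r E (na + 1 + i) = b i := by
        intro i hi
        induction i, hi using Nat.le_induction with
        | base => exact hE.2
        | succ i hi ih => exact hsub i hi ⟨E, ⟨hE.1, ih⟩, rfl⟩ ⟨C, ⟨hC.1, rfl⟩, rfl⟩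
      exact hS.ext_of_r fun n => hS.r_eq_of_le (hEC (k + n) (by omega)) (by omega)
    obtain ⟨q, -, hq, hlen, hqC⟩ := hreach k
    refine hσ.mem_of_seg_subsingleton hS hC.2 (b := b k) (H := H) ?_ ?_ hq
      (huniq _ (S.seg_mono hC.1 _ _ hqC))
    · rwa [hlen]
    · rw [hlen]
      exact ⟨hC.1, rfl⟩

/-- Playing `H` first and then repeating the objects of player II wins for player I as soon as
`[a, H] ⊆ X`. -/
theorem IsTRS.iWinning_of_seg_subset (hS : S.IsTRS) {X : Set R} {a : α} {na : ℕ} {A H : R}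
    (hH : H ∈ S.seg a na A) (hHX : S.seg a na H ⊆ X) :
    S.IWinning X a na A fun p => (p.getLast?.map Prod.snd).getD H := by
  have hsucc : ∀ (ak : ℕ → α) (Bk : ℕ → R) (k : ℕ),
      playI (fun p => (p.getLast?.map Prod.snd).getD H) ak Bk (k + 1) = Bk (k + 1) := by
    intro ak Bk k
    rw [playI, List.ofFn_succ_last]
    simp
  constructor
  · rintro ak Bk rfl rfl (_ | k) h
    · exact hH
    · have := (h k k.lt_succ_self).2.2
      rw [ruleI, hsucc]
      exact ⟨S.le_refl _, this.2⟩
  · intro ak Bk rfl rfl h C hC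
    have hCk : ∀ k, S.r C (na + k) = ak k := Set.mem_iInter.1 (hC.subset rfl)
    have hB : ∀ k, S.le (Bk (k + 1)) H := by
      intro k
      induction k with
      | zero => exact (h 0).2.2.2.1
      | succ k ih =>
        have := (h (k + 1)).2.2.2.1
        rw [hsucc] at this
        exact S.le_trans this ih
    refine hHX ⟨(hS.2.2.1.2.2.2.1 C H).2 fun n => ?_, hCk 0⟩
    have hBk := (h n).2.2.2.2
    rw [← hCk (n + 1)] at hBk
    rw [← hS.r_eq_of_le hBk (by omega : n ≤ na + n + 1)]
    exact hS.hasDepth_of_le (hB n) n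

/-- In a topological Ramsey space, player I has a winning strategy in the
abstract Kastanas game `𝒢_{[a,A]}(𝒳)` iff there exists `H ∈ [a,A]` with `[a,H] ⊆ 𝒳`. -/
theorem playerI_winning_iff (S : CombStruct R α) (hTRS : S.IsTRS) (X : Set R)
    (a : α) (na : ℕ) (A : R) (ha : a ∈ S.ARn na) (hne : (S.seg a na A).Nonempty) :
    (∃ σ : List (α × R) → R, S.IWinning X a na A σ) ↔
      ∃ H ∈ S.seg a na A, S.seg a na H ⊆ X := by
  constructor
  · rintro ⟨σ, hσ⟩
    exact hσ.exists_seg_subset hTRS ha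
  · rintro ⟨H, hH, hHX⟩
    exact ⟨_, hTRS.iWinning_of_seg_subset hH hHX⟩

end CombStruct
end AbstractTRS
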